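/- arXiv:1512.01011 — 5 statements merged into one kernel-verified Lean document; each statement's English description precedes it below -/
import Mathlib

section
/- Let (V_ℚ, {V^{p,q}}, h) be a rational polarized Hodge structure of weight w and W ⊆ V_ℚ a Hodge substructure. Then the restriction of h to W is nondegenerate, V_ℚ is the internal direct sum of W and its h-orthogonal complement W^⊥ = {v ∈ V_ℚ : h(v, w) = 0 for all w ∈ W}, and W^⊥ is again a Hodge substructure. -/
open TensorProduct

noncomputable section

/-- Complex conjugation on `ℂ` as a `ℚ`-linear map. -/
def conjQ : ℂ →ₗ[ℚ] ℂ where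
  toFun z := (starRingEnd ℂ) z
  map_add' := by simp
  map_smul' q z := by simp [Rat.smul_def, map_mul]

variable (V : Type) [AddCommGroup V] [Module ℚ V]

/-- Complex conjugation on `V_ℂ = ℂ ⊗_ℚ V`, acting through the `ℂ` factor. -/
def conjV : ℂ ⊗[ℚ] V →ₗ[ℚ] ℂ ⊗[ℚ] V := LinearMap.rTensor V conjQ

/-- The canonical inclusion `V → V_ℂ`, `v ↦ 1 ⊗ v`. -/
def incl : V →ₗ[ℚ] ℂ ⊗[ℚ] V := TensorProduct.mk ℚ ℂ V 1

/-- A rational Hodge structure of weight `w` on `V`: a direct sum decomposition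
`V_ℂ = ⨁_{p+q=w} V^{p,q}` (here `H p` is `V^{p, w-p}`, with `H p = ⊥` for `p > w`)
such that conjugation maps `V^{p,q}` onto `V^{q,p}`. -/
structure HodgeStructure (w : ℕ) where
  H : ℕ → Submodule ℂ (ℂ ⊗[ℚ] V)
  bounded : ∀ p, w < p → H p = ⊥
  indep : iSupIndep H
  total : (⨆ p, H p) = ⊤
  conj_mem : ∀ p, ∀ x ∈ H p, conjV V x ∈ H (w - p)

/-- A polarized rational Hodge structure of weight `w`. -/
structure PolarizedHodgeStructure (w : ℕ) extends HodgeStructure V w where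
  pol : V →ₗ[ℚ] V →ₗ[ℚ] ℚ
  polC : (ℂ ⊗[ℚ] V) →ₗ[ℂ] (ℂ ⊗[ℚ] V) →ₗ[ℂ] ℂ
  polC_ext : ∀ x y : V, polC (incl V x) (incl V y) = (pol x y : ℂ)
  pol_symm : ∀ x y, pol x y = (-1) ^ w * pol y x
  pol_nondeg : ∀ x, (∀ y, pol x y = 0) → x = 0
  pol_orth : ∀ p p', p + p' ≠ w → ∀ x ∈ H p, ∀ y ∈ H p', polC x y = 0
  pol_pos : ∀ p, ∀ x ∈ H p, x ≠ 0 →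
    ∃ r : ℝ, 0 < r ∧ -(Complex.I ^ (2 * (p : ℤ) - (w : ℤ))) * polC x (conjV V x) = (r : ℂ)

/-- The complexification `W ⊗_ℚ ℂ ⊆ V_ℂ` of a rational subspace `W ⊆ V`. -/
def complexify (W : Submodule ℚ V) : Submodule ℂ (ℂ ⊗[ℚ] V) :=
  Submodule.span ℂ (incl V '' (W : Set V))

/-- A Hodge substructure: a rational subspace `W` with
`W_ℂ = ⨁_p (W_ℂ ∩ V^{p,q})`. -/
def IsHodgeSub {w : ℕ} (HS : HodgeStructure V w) (W : Submodule ℚ V) : Prop :=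
  complexify V W = ⨆ p, complexify V W ⊓ HS.H p

/-- The orthogonal complement `W^⊥ = {v : h(v, w) = 0 ∀ w ∈ W}` of `W`
with respect to a bilinear form `h`. -/
def orthCompl (h : V →ₗ[ℚ] V →ₗ[ℚ] ℚ) (W : Submodule ℚ V) : Submodule ℚ V where
  carrier := {v | ∀ x ∈ W, h v x = 0}
  add_mem' := by
    intro a b ha hb x hx
    simp [map_add, ha x hx, hb x hx]
  zero_mem' := by intro x hx; simp
  smul_mem' := by
    intro c a ha x hx
    simp [map_smul, ha x hx]

theorem hs_conj_smul (a : ℂ) (x : ℂ ⊗[ℚ] V) :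
    conjV V (a • x) = (starRingEnd ℂ a) • conjV V x := by
  induction x using TensorProduct.induction_on with
  | zero => simp
  | tmul b v => simp [conjV, conjQ, TensorProduct.smul_tmul']
  | add x y h1 h2 => rw [smul_add, map_add, map_add, smul_add, h1, h2]

theorem hs_conj_mem (W : Submodule ℚ V) (x : ℂ ⊗[ℚ] V) (hx : x ∈ complexify V W) :
    conjV V x ∈ complexify V W := by
  unfold complexify at hx
  induction hx using Submodule.span_induction with
  | mem x h =>
    obtain ⟨v, hv, rfl⟩ := h
    have : conjV V (incl V v) = incl V v := by simp [conjV, incl, conjQ]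
    rw [this]
    exact Submodule.subset_span ⟨v, hv, rfl⟩
  | zero => simp
  | add x y _ _ hx hy => rw [map_add]; exact add_mem hx hy
  | smul a x _ hx =>
    rw [hs_conj_smul]
    exact Submodule.smul_mem _ _ hx

theorem hs_orth_ext {w : ℕ} (P : PolarizedHodgeStructure V w) (U W : Submodule ℚ V)
    (h : ∀ x ∈ U, ∀ y ∈ W, P.pol x y = 0) :
    ∀ x ∈ complexify V U, ∀ y ∈ complexify V W, P.polC x y = 0 := by
  intro x hx y hy
  unfold complexify at hx hy
  induction hx using Submodule.span_induction with
  | mem x hx =>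
    obtain ⟨u, hu, rfl⟩ := hx
    induction hy using Submodule.span_induction with
    | mem y hy =>
      obtain ⟨v, hv, rfl⟩ := hy
      rw [P.polC_ext, h u hu v hv]; simp
    | zero => simp
    | add x y _ _ hx hy => simp [hx, hy]
    | smul a x _ hx => simp [hx]
  | zero => simp
  | add x y _ _ hx hy => simp [hx, hy]
  | smul a x _ hx => simp [hx]

/-- Components of a sum pair with the complementary degree only. -/
theorem hs_component {w : ℕ} (P : PolarizedHodgeStructure V w) (f : ℕ →₀ ℂ ⊗[ℚ] V)
    (hf : ∀ p, f p ∈ P.H p) (p q : ℕ) (hpq : p + q = w) (y : ℂ ⊗[ℚ] V) (hy : y ∈ P.H q) :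
    P.polC (f.sum fun _ z => z) y = P.polC (f p) y := by
  rw [Finsupp.sum, map_sum, LinearMap.sum_apply]
  refine Finset.sum_eq_single p (fun b _ hb => ?_) (fun hp => ?_)
  · exact P.pol_orth b q (by omega) _ (hf b) _ hy
  · simp [Finsupp.notMem_support_iff.1 hp]

theorem hs_nondeg {w : ℕ} (P : PolarizedHodgeStructure V w) (W : Submodule ℚ V)
    (hW : IsHodgeSub V P.toHodgeStructure W) (x : ℂ ⊗[ℚ] V) (hx : x ∈ complexify V W)
    (h : ∀ y ∈ complexify V W, P.polC x y = 0) : x = 0 := by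
  rw [hW, Submodule.mem_iSup_iff_exists_finsupp] at hx
  obtain ⟨f, hf, rfl⟩ := hx
  have key : ∀ p, f p = 0 := by
    intro p
    by_cases hp : w < p
    · have := (hf p).2
      rw [P.bounded p hp] at this
      simpa using this
    by_contra hne
    obtain ⟨r, hr, he⟩ := P.pol_pos p (f p) (hf p).2 hne
    have h1 := hs_component V P f (fun p => (hf p).2) p (w - p) (by omega) _
      (P.conj_mem p _ (hf p).2)
    rw [h _ (hs_conj_mem V W _ (hf p).1)] at h1
    rw [← h1, mul_zero] at he
    exact hr.ne (by exact_mod_cast he)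
  simp [Finsupp.sum, key]

/-- for a Hodge substructure `W` of a rational polarized Hodge
structure `(V, {V^{p,q}}, h)`, the restriction of `h` to `W` is nondegenerate,
`V` is the internal direct sum of `W` and `W^⊥`, and `W^⊥` is again a Hodge
substructure. -/
theorem hodgeSub_orthogonal_complement [FiniteDimensional ℚ V] (w : ℕ)
    (P : PolarizedHodgeStructure V w) (W : Submodule ℚ V)
    (hW : IsHodgeSub V P.toHodgeStructure W) :
    (∀ x ∈ W, (∀ y ∈ W, P.pol x y = 0) → x = 0) ∧
    IsCompl W (orthCompl V P.pol W) ∧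
    IsHodgeSub V P.toHodgeStructure (orthCompl V P.pol W) := by
  have hinj : ∀ x : V, incl V x = 0 → x = 0 := by
    intro x hx
    have := Module.Flat.rTensor_preserves_injective_linearMap (M := V)
      (Algebra.linearMap ℚ ℂ) (algebraMap ℚ ℂ).injective
    have h2 : LinearMap.rTensor V (Algebra.linearMap ℚ ℂ) ((1 : ℚ) ⊗ₜ[ℚ] x) = 0 := by
      simpa [incl] using hx
    have h3 := this (h2.trans (map_zero _).symm)
    simpa using congrArg (TensorProduct.lid ℚ V) h3
  have hnd : ∀ x ∈ W, (∀ y ∈ W, P.pol x y = 0) → x = 0 := by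
    intro x hx h
    apply hinj
    refine hs_nondeg V P W hW _ (Submodule.subset_span ⟨x, hx, rfl⟩) fun y hy => ?_
    refine hs_orth_ext V P (ℚ ∙ x) W ?_ _ (Submodule.subset_span
      ⟨x, Submodule.mem_span_singleton_self x, rfl⟩) y hy
    intro z hz y hy
    obtain ⟨a, rfl⟩ := Submodule.mem_span_singleton.1 hz
    simp [h y hy]
  have hrefl : ∀ x y, P.pol x y = 0 → P.pol y x = 0 := by
    intro x y h
    rw [P.pol_symm, h, mul_zero]
  have hO : orthCompl V P.pol W = LinearMap.BilinForm.orthogonal P.pol W := by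
    ext v
    rw [LinearMap.BilinForm.mem_orthogonal_iff]
    exact ⟨fun h x hx => hrefl _ _ (h x hx), fun h x hx => hrefl _ _ (h x hx)⟩
  have hcompl : IsCompl W (orthCompl V P.pol W) := by
    have hd : Disjoint W (orthCompl V P.pol W) := by
      rw [Submodule.disjoint_def]
      exact fun x hx h => hnd x hx h
    rw [hO] at hd ⊢
    exact (LinearMap.BilinForm.isCompl_orthogonal_iff_disjoint hrefl).2 hd
  refine ⟨hnd, hcompl, ?_⟩
  have hsum : complexify V W ⊔ complexify V (orthCompl V P.pol W) = ⊤ := by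
    rw [eq_top_iff]
    intro z _
    induction z using TensorProduct.induction_on with
    | zero => exact zero_mem _
    | add x y h1 h2 => exact add_mem (h1 trivial) (h2 trivial)
    | tmul c v =>
      have hv : v ∈ W ⊔ orthCompl V P.pol W := by rw [hcompl.sup_eq_top]; trivial
      obtain ⟨a, ha, b, hb, rfl⟩ := Submodule.mem_sup.1 hv
      have : c ⊗ₜ[ℚ] (a + b) = c • incl V a + c • incl V b := by
        simp [incl, TensorProduct.smul_tmul', TensorProduct.tmul_add]
      rw [this]
      exact Submodule.add_mem_sup
        (Submodule.smul_mem _ _ (Submodule.subset_span ⟨a, ha, rfl⟩))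
        (Submodule.smul_mem _ _ (Submodule.subset_span ⟨b, hb, rfl⟩))
  have horth := hs_orth_ext V P (orthCompl V P.pol W) W (fun x hx y hy => hx y hy)
  unfold IsHodgeSub
  refine le_antisymm (fun z hz => ?_) (iSup_le fun p => inf_le_left)
  have hz' : z ∈ ⨆ p, P.H p := by rw [P.total]; trivial
  rw [Submodule.mem_iSup_iff_exists_finsupp] at hz'
  obtain ⟨f, hf, rfl⟩ := hz'
  refine Submodule.sum_mem _ fun p _ => Submodule.mem_iSup_of_mem p ⟨?_, hf p⟩
  have hfp : ∀ y ∈ complexify V W, P.polC (f p) y = 0 := by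
    intro y hy
    rw [hW, Submodule.mem_iSup_iff_exists_finsupp] at hy
    obtain ⟨g, hg, rfl⟩ := hy
    rw [Finsupp.sum, map_sum]
    refine Finset.sum_eq_zero fun q _ => ?_
    by_cases hpq : p + q = w
    · rw [← hs_component V P f hf p q hpq _ (hg q).2]
      exact horth _ hz _ (hg q).1
    · exact P.pol_orth p q hpq _ (hf p) _ (hg q).2
  have hmem : f p ∈ complexify V W ⊔ complexify V (orthCompl V P.pol W) := by
    rw [hsum]; trivial
  obtain ⟨a, ha, b, hb, hab⟩ := Submodule.mem_sup.1 hmem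
  have ha0 : a = 0 := by
    refine hs_nondeg V P W hW a ha fun y hy => ?_
    have h1 := hfp y hy
    rw [← hab, map_add, LinearMap.add_apply, horth b hb y hy, add_zero] at h1
    exact h1
  rw [← hab, ha0, zero_add]
  exact hb
end
end

section
/- Every rational polarized Hodge structure of weight w is semisimple: V_ℚ is an internal direct sum of finitely many Hodge substructures, each of which is simple (has no Hodge substructures other than 0 and itself). -/
open TensorProduct

noncomputable section

variable (V : Type) [AddCommGroup V] [Module ℚ V]

namespace HodgeAux

variable {V}

lemma exists_proj {w : ℕ} (P : HodgeStructure V w) :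
    ∃ pr : ℕ → (ℂ ⊗[ℚ] V) →ₗ[ℂ] (ℂ ⊗[ℚ] V),
      (∀ p x, pr p x ∈ P.H p) ∧ (∀ p, ∀ x ∈ P.H p, pr p x = x) ∧
      (∀ p q, p ≠ q → ∀ x ∈ P.H q, pr p x = 0) ∧
      ∀ x, ∑ p ∈ Finset.range (w + 1), pr p x = x := by
  classical
  have hI := DirectSum.isInternal_submodule_of_iSupIndep_of_iSup_eq_top P.indep P.total
  letI := hI.chooseDecomposition
  let pr : ℕ → (ℂ ⊗[ℚ] V) →ₗ[ℂ] (ℂ ⊗[ℚ] V) := fun p =>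
    (P.H p).subtype ∘ₗ (DirectSum.component ℂ ℕ (fun i => P.H i) p) ∘ₗ
      (DirectSum.decomposeLinearEquiv P.H).toLinearMap
  have h0 : ∀ p x, pr p x = (DirectSum.decompose P.H x p : ℂ ⊗[ℚ] V) := fun p x => rfl
  have h2 : ∀ p, ∀ x ∈ P.H p, pr p x = x := fun p x hx => by
    rw [h0, DirectSum.decompose_of_mem_same _ hx]
  have h3 : ∀ p q, p ≠ q → ∀ x ∈ P.H q, pr p x = 0 := fun p q hpq x hx => by
    rw [h0, DirectSum.decompose_of_mem_ne _ hx hpq.symm]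
  refine ⟨pr, fun p x => by rw [h0]; exact Subtype.prop _, h2, h3, fun x => ?_⟩
  have hx : x ∈ ⨆ p, P.H p := by rw [P.total]; trivial
  induction hx using Submodule.iSup_induction' with
  | mem q x hx =>
    by_cases hq : q ≤ w
    · rw [Finset.sum_eq_single q]
      · exact h2 q x hx
      · intro b _ hb
        exact h3 b q hb x hx
      · intro h
        exact absurd (Finset.mem_range.2 (by omega)) h
    · rw [P.bounded q (by omega)] at hx
      rw [(Submodule.mem_bot ℂ).1 hx]
      simp
  | zero => simp
  | add x y _ _ hx hy => simp only [map_add, Finset.sum_add_distrib, hx, hy]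

lemma hodge_iff {w : ℕ} (P : HodgeStructure V w)
    (pr : ℕ → (ℂ ⊗[ℚ] V) →ₗ[ℂ] (ℂ ⊗[ℚ] V))
    (h1 : ∀ p x, pr p x ∈ P.H p) (h2 : ∀ p, ∀ x ∈ P.H p, pr p x = x)
    (h3 : ∀ p q, p ≠ q → ∀ x ∈ P.H q, pr p x = 0)
    (h4 : ∀ x, ∑ p ∈ Finset.range (w + 1), pr p x = x) (W : Submodule ℚ V) :
    IsHodgeSub V P W ↔ ∀ p, ∀ x ∈ complexify V W, pr p x ∈ complexify V W := by
  constructor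
  · intro h p x hx
    unfold IsHodgeSub at h
    have hx' : x ∈ ⨆ p, complexify V W ⊓ P.H p := h ▸ hx
    clear hx
    induction hx' using Submodule.iSup_induction' with
    | mem q x hx =>
      by_cases hpq : p = q
      · subst hpq
        rw [h2 p x hx.2]; exact hx.1
      · rw [h3 p q hpq x hx.2]; exact zero_mem _
    | zero => rw [map_zero]; exact zero_mem _
    | add x y _ _ hx hy => rw [map_add]; exact add_mem hx hy
  · intro h
    refine le_antisymm (fun x hx => ?_) (iSup_le fun p => inf_le_left)
    rw [← h4 x]
    exact Submodule.sum_mem _ fun p _ =>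
      Submodule.mem_iSup_of_mem p ⟨h p x hx, h1 p x⟩

/-- a coordinate of an element of `ℂ ⊗ V` along a rational functional on `ℂ`. -/
def crd (φ : ℂ →ₗ[ℚ] ℚ) : ℂ ⊗[ℚ] V →ₗ[ℚ] V :=
  (TensorProduct.lid ℚ V).toLinearMap ∘ₗ LinearMap.rTensor V φ

@[simp] lemma crd_tmul (φ : ℂ →ₗ[ℚ] ℚ) (z : ℂ) (v : V) : crd φ (z ⊗ₜ[ℚ] v) = φ z • v := by
  simp [crd]

lemma tmul_mem {W : Submodule ℚ V} (z : ℂ) {v : V} (hv : v ∈ W) :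
    z ⊗ₜ[ℚ] v ∈ complexify V W := by
  have : z ⊗ₜ[ℚ] v = z • incl V v := by
    simp [incl, TensorProduct.smul_tmul']
  rw [this]
  exact Submodule.smul_mem _ _ (Submodule.subset_span ⟨v, hv, rfl⟩)

lemma complexify_induction {W : Submodule ℚ V} {p : ℂ ⊗[ℚ] V → Prop}
    (h0 : p 0) (ha : ∀ x y, p x → p y → p (x + y)) (ht : ∀ z : ℂ, ∀ v ∈ W, p (z ⊗ₜ[ℚ] v))
    {x : ℂ ⊗[ℚ] V} (hx : x ∈ complexify V W) : p x := by
  unfold complexify at hx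
  induction hx using Submodule.closure_induction with
  | zero => exact h0
  | add x y _ _ hx hy => exact ha x y hx hy
  | smul_mem r x hx =>
    obtain ⟨v, hv, rfl⟩ := hx
    have : r • incl V v = r ⊗ₜ[ℚ] v := by simp [incl, TensorProduct.smul_tmul']
    rw [this]
    exact ht r v hv

lemma mem_complexify_iff (W : Submodule ℚ V) (x : ℂ ⊗[ℚ] V) :
    x ∈ complexify V W ↔ ∀ φ : ℂ →ₗ[ℚ] ℚ, crd φ x ∈ W := by
  classical
  constructor
  · intro hx φ
    refine complexify_induction (p := fun x => crd φ x ∈ W) ?_ ?_ ?_ hx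
    · simp
    · intro x y hx hy; rw [map_add]; exact add_mem hx hy
    · intro z v hv; rw [crd_tmul]; exact W.smul_mem _ hv
  · intro h
    let b := Module.Basis.ofVectorSpace ℚ ℂ
    rw [← (TensorProduct.equivFinsuppOfBasisLeft b).symm_apply_apply x,
      TensorProduct.equivFinsuppOfBasisLeft_symm_apply]
    refine Submodule.sum_mem _ fun i _ => tmul_mem _ ?_
    rw [TensorProduct.equivFinsuppOfBasisLeft_apply]
    exact h (b.coord i)

lemma complexify_inf (W U : Submodule ℚ V) :
    complexify V (W ⊓ U) = complexify V W ⊓ complexify V U := by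
  ext x
  simp only [Submodule.mem_inf, mem_complexify_iff, forall_and]

lemma conj_mem_complexify {W : Submodule ℚ V} {x : ℂ ⊗[ℚ] V} (hx : x ∈ complexify V W) :
    conjV V x ∈ complexify V W := by
  refine complexify_induction (p := fun x => conjV V x ∈ complexify V W) ?_ ?_ ?_ hx
  · simp
  · intro x y hx hy; rw [map_add]; exact add_mem hx hy
  · intro z v hv
    simp only [conjV, LinearMap.rTensor_tmul]
    exact tmul_mem _ hv

lemma polC_tmul {w : ℕ} (P : PolarizedHodgeStructure V w) (y z : ℂ) (u v : V) :
    P.polC (y ⊗ₜ[ℚ] u) (z ⊗ₜ[ℚ] v) = (y * z) * (P.pol u v : ℂ) := by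
  have h : ∀ (r : ℂ) (v : V), r ⊗ₜ[ℚ] v = r • incl V v := fun r v => by
    simp [incl, TensorProduct.smul_tmul']
  rw [h, h, map_smul, map_smul, LinearMap.smul_apply, P.polC_ext]
  simp only [smul_eq_mul]
  ring

lemma mem_orth_iff {w : ℕ} (P : PolarizedHodgeStructure V w) (U : Submodule ℚ V)
    (x : ℂ ⊗[ℚ] V) :
    x ∈ complexify V (LinearMap.BilinForm.orthogonal P.pol U) ↔
      ∀ y ∈ complexify V U, P.polC y x = 0 := by
  have key : ∀ (φ : ℂ →ₗ[ℚ] ℚ) (u : V) (x : ℂ ⊗[ℚ] V),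
      P.pol u (crd φ x) = φ (P.polC (1 ⊗ₜ[ℚ] u) x) := by
    intro φ u x
    induction x using TensorProduct.induction_on with
    | zero => simp
    | add x y hx hy => simp only [map_add, hx, hy]
    | tmul z v =>
      rw [polC_tmul, crd_tmul, map_smul, one_mul]
      have : z * (P.pol u v : ℂ) = (P.pol u v) • z := by rw [Rat.smul_def, mul_comm]
      rw [this, map_smul, smul_eq_mul, smul_eq_mul, mul_comm]
  constructor
  · intro hx y hy
    refine complexify_induction (p := fun x => P.polC y x = 0) ?_ ?_ ?_ hx
    · simp
    · intro a b ha hb; rw [map_add, ha, hb, add_zero]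
    · intro z v hv
      refine complexify_induction (p := fun y => P.polC y (z ⊗ₜ[ℚ] v) = 0) ?_ ?_ ?_ hy
      · simp
      · intro a b ha hb; rw [map_add, LinearMap.add_apply, ha, hb, add_zero]
      · intro t u hu
        have : P.pol u v = 0 := hv u hu
        rw [polC_tmul, this]; simp
  · intro h
    rw [mem_complexify_iff]
    intro φ u hu
    show P.pol u (crd φ x) = 0
    rw [key, h _ (tmul_mem 1 hu), map_zero]

lemma hodge_inf {w : ℕ} (P : HodgeStructure V w) {W U : Submodule ℚ V}
    (hW : IsHodgeSub V P W) (hU : IsHodgeSub V P U) : IsHodgeSub V P (W ⊓ U) := by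
  obtain ⟨pr, h1, h2, h3, h4⟩ := exists_proj P
  rw [hodge_iff P pr h1 h2 h3 h4] at *
  intro p x hx
  rw [complexify_inf] at *
  exact ⟨hW p x hx.1, hU p x hx.2⟩

lemma hodge_orth {w : ℕ} (P : PolarizedHodgeStructure V w) {U : Submodule ℚ V}
    (hU : IsHodgeSub V P.toHodgeStructure U) :
    IsHodgeSub V P.toHodgeStructure (LinearMap.BilinForm.orthogonal P.pol U) := by
  obtain ⟨pr, h1, h2, h3, h4⟩ := exists_proj P.toHodgeStructure
  rw [hodge_iff P.toHodgeStructure pr h1 h2 h3 h4] at *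
  intro p x hx
  rw [mem_orth_iff] at *
  intro y hy
  rw [← h4 y, map_sum, LinearMap.sum_apply]
  refine Finset.sum_eq_zero fun q _ => ?_
  by_cases hqp : q + p = w
  · have h := hx _ (hU q y hy)
    rw [← h4 x, map_sum, Finset.sum_eq_single p] at h
    · exact h
    · intro b _ hb
      exact P.pol_orth q b (by omega) _ (h1 _ _) _ (h1 _ _)
    · intro hp
      exact absurd (Finset.mem_range.2 (by omega)) hp
  · exact P.pol_orth q p hqp _ (h1 _ _) _ (h1 _ _)

lemma disjoint_orth {w : ℕ} (P : PolarizedHodgeStructure V w) {U : Submodule ℚ V}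
    (hU : IsHodgeSub V P.toHodgeStructure U) :
    Disjoint U (LinearMap.BilinForm.orthogonal P.pol U) := by
  have hO := hodge_orth P hU
  have hK := hodge_inf _ hU hO
  rw [disjoint_iff]
  have hz : complexify V (U ⊓ LinearMap.BilinForm.orthogonal P.pol U) = ⊥ := by
    unfold IsHodgeSub at hK
    rw [hK, iSup_eq_bot]
    intro p
    rw [eq_bot_iff]
    rintro x ⟨hx, hxp⟩
    rw [Submodule.mem_bot]
    by_contra hne
    obtain ⟨r, hr, hr'⟩ := P.pol_pos p x hxp hne
    have hc := conj_mem_complexify hx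
    rw [complexify_inf] at hx hc
    rw [(mem_orth_iff P U _).1 hc.2 x hx.1, mul_zero] at hr'
    exact hr.ne (by exact_mod_cast hr')
  rw [eq_bot_iff]
  intro v hv
  have h := tmul_mem 1 hv
  rw [hz, Submodule.mem_bot] at h
  obtain ⟨φ, hφ⟩ : ∃ φ : ℂ →ₗ[ℚ] ℚ, φ 1 = 1 := by
    obtain ⟨φ, hφ⟩ := LinearMap.exists_leftInverse_of_injective
      (LinearMap.toSpanSingleton ℚ ℂ 1)
      (LinearMap.ker_toSpanSingleton (R := ℚ) (M := ℂ) one_ne_zero)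
    refine ⟨φ, ?_⟩
    have h1 := LinearMap.congr_fun hφ 1
    simpa using h1
  have := congrArg (crd φ) h
  rw [crd_tmul, hφ, one_smul, map_zero] at this
  exact (Submodule.mem_bot ℚ).2 this

lemma isCompl_orth [FiniteDimensional ℚ V] {w : ℕ} (P : PolarizedHodgeStructure V w)
    {U : Submodule ℚ V} (hU : IsHodgeSub V P.toHodgeStructure U) :
    IsCompl U (LinearMap.BilinForm.orthogonal P.pol U) := by
  refine (LinearMap.BilinForm.isCompl_orthogonal_iff_disjoint ?_).2 (disjoint_orth P hU)
  intro x y h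
  rw [P.pol_symm, h, mul_zero]

lemma main_aux [FiniteDimensional ℚ V] {w : ℕ} (P : PolarizedHodgeStructure V w) (d : ℕ) :
    ∀ W : Submodule ℚ V, IsHodgeSub V P.toHodgeStructure W → Module.finrank ℚ W ≤ d →
    ∃ s : Finset (Submodule ℚ V), (∀ U ∈ s, IsHodgeSub V P.toHodgeStructure U ∧
      ∀ U' : Submodule ℚ V, IsHodgeSub V P.toHodgeStructure U' → U' ≤ U → U' = ⊥ ∨ U' = U) ∧
      s.SupIndep id ∧ s.sup id = W := by
  classical
  induction d with
  | zero =>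
    intro W _ hd
    have : W = ⊥ := Submodule.finrank_eq_zero.1 (by omega)
    exact ⟨∅, by simp, by simp, by simp [this]⟩
  | succ d ih =>
    intro W hW hd
    by_cases hs : ∀ U' : Submodule ℚ V, IsHodgeSub V P.toHodgeStructure U' → U' ≤ W →
        U' = ⊥ ∨ U' = W
    · refine ⟨{W}, ?_, by simp, by simp⟩
      intro U hU
      rw [Finset.mem_singleton] at hU
      subst hU
      exact ⟨hW, hs⟩
    · push Not at hs
      obtain ⟨U, hU, hUW, hb, hne⟩ := hs
      set O := LinearMap.BilinForm.orthogonal P.pol U with hOdef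
      have hc : IsCompl U O := isCompl_orth P hU
      have hO : IsHodgeSub V P.toHodgeStructure (W ⊓ O) := hodge_inf _ hW (hodge_orth P hU)
      have hsup : U ⊔ W ⊓ O = W := by
        rw [inf_comm, ← sup_inf_assoc_of_le O hUW, hc.sup_eq_top, top_inf_eq]
      have hlt : W ⊓ O < W := by
        refine lt_of_le_of_ne inf_le_left fun h => hb ?_
        have hWO : W ≤ O := inf_eq_left.1 h
        exact hc.disjoint.eq_bot_of_le (hUW.trans hWO)
      obtain ⟨s, hs1, hs2, hs3⟩ := ih U hU (by
        have := Submodule.finrank_lt_finrank_of_lt (lt_of_le_of_ne hUW hne); omega)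
      obtain ⟨t, ht1, ht2, ht3⟩ := ih _ hO (by
        have := Submodule.finrank_lt_finrank_of_lt hlt; omega)
      refine ⟨s ∪ t, ?_, ?_, ?_⟩
      · intro X hX
        rcases Finset.mem_union.1 hX with h | h
        · exact hs1 X h
        · exact ht1 X h
      · refine Finset.SupIndep.union hs2 ht2 ?_
        rw [hs3, ht3]
        exact hc.disjoint.mono_right inf_le_right
      · rw [Finset.sup_union, hs3, ht3, hsup]

end HodgeAux

/-- every rational polarized Hodge structure is semisimple: `V` is
an internal direct sum of finitely many Hodge substructures, each of which is
simple (has no Hodge substructures other than `0` and itself). -/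
theorem polarized_hodge_semisimple [FiniteDimensional ℚ V] (w : ℕ)
    (P : PolarizedHodgeStructure V w) :
    ∃ (n : ℕ) (W : Fin n → Submodule ℚ V),
      (∀ i, IsHodgeSub V P.toHodgeStructure (W i)) ∧
      (∀ i, ∀ U : Submodule ℚ V, IsHodgeSub V P.toHodgeStructure U → U ≤ W i →
        U = ⊥ ∨ U = W i) ∧
      iSupIndep W ∧ (⨆ i, W i) = ⊤ := by
  classical
  have htop : IsHodgeSub V P.toHodgeStructure ⊤ := by
    obtain ⟨pr, h1, h2, h3, h4⟩ := HodgeAux.exists_proj P.toHodgeStructure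
    rw [HodgeAux.hodge_iff P.toHodgeStructure pr h1 h2 h3 h4]
    intro p x _
    rw [HodgeAux.mem_complexify_iff]
    intro φ
    trivial
  obtain ⟨s, hs1, hs2, hs3⟩ := HodgeAux.main_aux P _ ⊤ htop le_rfl
  let e : Fin s.card ≃ s := s.equivFin.symm
  refine ⟨s.card, fun i => (e i : Submodule ℚ V), fun i => (hs1 _ (e i).2).1,
    fun i => (hs1 _ (e i).2).2, ?_, ?_⟩
  · have h := iSupIndep_comp_coe_iff_supIndep.2 hs2
    exact h.comp e.injective
  · rw [← hs3, Finset.sup_eq_iSup, e.iSup_comp (g := fun x : s => (x : Submodule ℚ V)),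
      iSup_subtype]
    rfl
end
end

section
/- Let (V_ℚ, {V^{p,q}}, h) be a simple rational polarized Hodge structure of K3 type, E the field of its Hodge endomorphisms, a* the h-adjoint of a ∈ E, and λ : E → ℂ the embedding sending a to the scalar by which a acts on V^{2,0}. Then for every nonzero a ∈ E, λ(a*·a) is a positive real number. -/
open TensorProduct

noncomputable section

variable (V : Type) [AddCommGroup V] [Module ℚ V]

/-- A Hodge endomorphism: a `ℚ`-linear endomorphism whose complexification
preserves each `V^{p,q}`. -/
def IsHodgeEnd {w : ℕ} (HS : HodgeStructure V w) (a : V →ₗ[ℚ] V) : Prop :=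
  ∀ p, ∀ x ∈ HS.H p, LinearMap.baseChange ℂ a x ∈ HS.H p

theorem conjV_smul_aux (c : ℂ) (x : ℂ ⊗[ℚ] V) :
    conjV V (c • x) = (starRingEnd ℂ c) • conjV V x := by
  induction x using TensorProduct.induction_on with
  | zero => simp
  | tmul z v => simp [conjV, conjQ, TensorProduct.smul_tmul']
  | add x y hx hy => rw [smul_add, map_add, hx, hy, map_add, smul_add]

theorem conjV_baseChange_aux (f : V →ₗ[ℚ] V) (x : ℂ ⊗[ℚ] V) :
    conjV V (LinearMap.baseChange ℂ f x) = LinearMap.baseChange ℂ f (conjV V x) := by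
  induction x using TensorProduct.induction_on with
  | zero => simp
  | tmul z v => simp [conjV]
  | add x y hx hy => rw [map_add, map_add, hx, hy, map_add, map_add]

theorem tmul_eq_aux (z : ℂ) (v : V) : z ⊗ₜ[ℚ] v = z • incl V v := by
  simp [incl, TensorProduct.smul_tmul']

theorem polC_adj_aux {w : ℕ} (P : PolarizedHodgeStructure V w) (a astar : V →ₗ[ℚ] V)
    (hadj : ∀ x y : V, P.pol (a x) y = P.pol x (astar y)) (x y : ℂ ⊗[ℚ] V) :
    P.polC (LinearMap.baseChange ℂ a x) y = P.polC x (LinearMap.baseChange ℂ astar y) := by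
  induction x using TensorProduct.induction_on with
  | zero => simp
  | add x x' hx hx' => simp only [map_add, LinearMap.add_apply, hx, hx']
  | tmul z v =>
    induction y using TensorProduct.induction_on with
    | zero => simp
    | add x x' hx hx' => simp only [map_add, hx, hx']
    | tmul z' v' =>
      rw [LinearMap.baseChange_tmul, LinearMap.baseChange_tmul]
      simp only [tmul_eq_aux, map_smul, LinearMap.smul_apply, P.polC_ext, hadj]

theorem complexify_range_aux (a : V →ₗ[ℚ] V) :
    complexify V (LinearMap.range a) = LinearMap.range (LinearMap.baseChange ℂ a) := by
  apply le_antisymm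
  · refine Submodule.span_le.2 ?_
    rintro _ ⟨_, ⟨v, rfl⟩, rfl⟩
    exact ⟨incl V v, by simp [incl]⟩
  · rintro _ ⟨x, rfl⟩
    induction x using TensorProduct.induction_on with
    | zero => simp
    | add x y hx hy => rw [map_add]; exact Submodule.add_mem _ hx hy
    | tmul z v =>
      rw [LinearMap.baseChange_tmul, tmul_eq_aux]
      exact Submodule.smul_mem _ _ (Submodule.subset_span ⟨a v, ⟨v, rfl⟩, rfl⟩)

theorem range_hodgeSub_aux {w : ℕ} (HS : HodgeStructure V w) (a : V →ₗ[ℚ] V)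
    (ha : IsHodgeEnd V HS a) : IsHodgeSub V HS (LinearMap.range a) := by
  unfold IsHodgeSub
  rw [complexify_range_aux]
  apply le_antisymm
  · conv_lhs => rw [LinearMap.range_eq_map, ← HS.total, Submodule.map_iSup]
    refine iSup_mono fun p => ?_
    rintro _ ⟨x, hx, rfl⟩
    refine ⟨?_, ha p x hx⟩
    exact ⟨x, rfl⟩
  · exact iSup_le fun p => inf_le_left

/-- for a simple rational polarized Hodge structure of K3 type
(weight 2, `dim V^{2,0} = 1`), a nonzero Hodge endomorphism `a` with `h`-adjoint
`a*`, the scalar `λ(a*·a)` by which `a*·a` acts on `V^{2,0}` is a positive real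
number. -/
theorem lambda_adjoint_mul_self_pos [FiniteDimensional ℚ V]
    (P : PolarizedHodgeStructure V 2)
    (hsimple : ∀ U : Submodule ℚ V, IsHodgeSub V P.toHodgeStructure U →
      U = ⊥ ∨ U = ⊤)
    (hK3 : Module.finrank ℂ (P.H 2) = 1)
    (a astar : V →ₗ[ℚ] V)
    (ha : IsHodgeEnd V P.toHodgeStructure a) (hne : a ≠ 0)
    (hadj : ∀ x y : V, P.pol (a x) y = P.pol x (astar y))
    (c : ℂ)
    (hc : ∀ x ∈ P.H 2, LinearMap.baseChange ℂ (astar ∘ₗ a) x = c • x) :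
    ∃ r : ℝ, 0 < r ∧ c = (r : ℂ) := by
  have hsurj : Function.Surjective a := by
    rcases hsimple _ (range_hodgeSub_aux V _ a ha) with h | h
    · exact absurd (LinearMap.range_eq_bot.1 h) hne
    · exact LinearMap.range_eq_top.1 h
  have hinj : Function.Injective a := LinearMap.injective_iff_surjective.2 hsurj
  have hinjC : Function.Injective (LinearMap.baseChange ℂ a) :=
    Module.Flat.lTensor_preserves_injective_linearMap (M := ℂ) a hinj
  obtain ⟨⟨x, hx⟩, hx0, -⟩ := finrank_eq_one_iff'.1 hK3
  have hx0 : x ≠ 0 := fun h => hx0 (by ext; exact h)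
  obtain ⟨r, hr, hrx⟩ := P.pol_pos 2 x hx hx0
  have hy0 : LinearMap.baseChange ℂ a x ≠ 0 := fun h => hx0 (hinjC (by rw [h, map_zero]))
  obtain ⟨s, hs, hsy⟩ := P.pol_pos 2 _ (ha 2 x hx) hy0
  have key : P.polC (LinearMap.baseChange ℂ a x) (conjV V (LinearMap.baseChange ℂ a x))
      = starRingEnd ℂ c * P.polC x (conjV V x) := by
    rw [polC_adj_aux V P a astar hadj, ← conjV_baseChange_aux, ← LinearMap.comp_apply,
      ← LinearMap.baseChange_comp, hc x hx, conjV_smul_aux, map_smul, smul_eq_mul]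
  rw [key, mul_left_comm, hrx] at hsy
  have hr' : (r : ℂ) ≠ 0 := by exact_mod_cast hr.ne'
  refine ⟨s / r, div_pos hs hr, ?_⟩
  have h1 : starRingEnd ℂ c = ((s / r : ℝ) : ℂ) := by
    push_cast
    exact eq_div_of_mul_eq hr' hsy
  have h2 := congrArg (starRingEnd ℂ) h1
  rwa [Complex.conj_conj, Complex.conj_ofReal] at h2
end
end

section
/- Let E be a number field (a field that is a finite-dimensional ℚ-algebra) and τ : E → E a ring automorphism with τ ∘ τ = id, such that for every nonzero a ∈ E and every ring homomorphism σ : E → ℂ, σ(a·τ(a)) is a positive real number. Then: (1) if τ = id, then E is totally real, i.e., every ring homomorphism E → ℂ has image contained in ℝ; (2) if τ ≠ id, then the fixed field E₀ = {a ∈ E : τ(a) = a} is totally real, [E : E₀] = 2, and E is totally imaginary, i.e., no ring homomorphism E → ℂ has image contained in ℝ. -/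
theorem real_of_sq_pos (z : ℂ) (r : ℝ) (hr : 0 < r) (h : z * z = (r : ℂ)) :
    z = (z.re : ℂ) := by
  have h1 := congrArg Complex.re h
  have h2 := congrArg Complex.im h
  simp only [Complex.mul_re, Complex.mul_im, Complex.ofReal_re, Complex.ofReal_im] at h1 h2
  have h3 : z.re * z.im = 0 := by linarith
  apply Complex.ext
  · simp
  · simp only [Complex.ofReal_im]
    rcases mul_eq_zero.mp h3 with h4 | h4
    · rw [h4] at h1
      nlinarith [mul_self_nonneg z.im]
    · exact h4

/-- let `E` be a number field and `τ : E → E` a ring involution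
such that `σ(a·τ(a))` is a positive real number for every nonzero `a ∈ E` and
every ring homomorphism `σ : E → ℂ`. Then (1) if `τ = id`, `E` is totally real;
(2) if `τ ≠ id`, the fixed field `E₀` of `τ` is totally real, `[E : E₀] = 2`,
and `E` is totally imaginary. -/
theorem involution_totally_real_or_cm (E : Type) [Field E] [Algebra ℚ E]
    [FiniteDimensional ℚ E] (τ : E ≃+* E) (hinv : ∀ a, τ (τ a) = a)
    (hpos : ∀ a : E, a ≠ 0 → ∀ σ : E →+* ℂ,
      ∃ r : ℝ, 0 < r ∧ σ (a * τ a) = (r : ℂ)) :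
    (τ = RingEquiv.refl E → ∀ σ : E →+* ℂ, ∀ a : E, ∃ r : ℝ, σ a = (r : ℂ)) ∧
    (τ ≠ RingEquiv.refl E →
      ∃ E₀ : Subalgebra ℚ E, (E₀ : Set E) = {a : E | τ a = a} ∧
        (∀ σ : E₀ →+* ℂ, ∀ a, ∃ r : ℝ, σ a = (r : ℂ)) ∧
        Module.finrank E₀ E = 2 ∧
        (∀ σ : E →+* ℂ, ∃ a : E, ∀ r : ℝ, σ a ≠ (r : ℂ))) := by
  have key : ∀ a : E, τ a = a → ∀ σ : E →+* ℂ, ∃ r : ℝ, σ a = (r : ℂ) := by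
    intro a ha σ
    by_cases h0 : a = 0
    · exact ⟨0, by simp [h0]⟩
    · obtain ⟨r, hr, h⟩ := hpos a h0 σ
      rw [ha, map_mul] at h
      exact ⟨_, real_of_sq_pos _ r hr h⟩
  have hchar : CharZero E := algebraRat.charZero E
  refine ⟨fun h σ a => key a (by rw [h]; rfl) σ, fun hne => ?_⟩
  obtain ⟨b, hb⟩ : ∃ b, τ b ≠ b := by
    by_contra hcon
    push Not at hcon
    exact hne (RingEquiv.ext hcon)
  obtain ⟨a, ha0, ha⟩ : ∃ a : E, a ≠ 0 ∧ τ a = -a :=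
    ⟨b - τ b, fun h => hb (sub_eq_zero.mp h).symm, by rw [map_sub, hinv]; ring⟩
  let E₀ : Subalgebra ℚ E :=
    { carrier := {a : E | τ a = a}
      mul_mem' := fun {x y} hx hy => by
        simp only [Set.mem_ofPred_eq] at *
        rw [map_mul, hx, hy]
      add_mem' := fun {x y} hx hy => by
        simp only [Set.mem_ofPred_eq] at *
        rw [map_add, hx, hy]
      algebraMap_mem' := fun r => by
        simp }
  have hmem : ∀ x : E, x ∈ E₀ ↔ τ x = x := fun x => Iff.rfl
  refine ⟨E₀, rfl, ?_, ?_, ?_⟩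
  · intro σ x
    have hinj : Function.Injective σ := by
      rw [injective_iff_map_eq_zero]
      intro y hy
      by_contra hy0
      have hy1 : (y : E) ≠ 0 := fun h => hy0 (Subtype.ext h)
      have hi : (y : E)⁻¹ ∈ E₀ := by
        rw [hmem, map_inv₀, (hmem _).1 y.2]
      have h1 : y * ⟨(y : E)⁻¹, hi⟩ = 1 := Subtype.ext (mul_inv_cancel₀ hy1)
      have h2 := congrArg σ h1
      rw [map_mul, hy, zero_mul, map_one] at h2
      exact zero_ne_one h2
    let : Algebra E₀ ℂ := σ.toAlgebra
    have : FaithfulSMul E₀ ℂ := (faithfulSMul_iff_algebraMap_injective E₀ ℂ).2 hinj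
    have : Module.IsTorsionFree E₀ ℂ := inferInstance
    have : Algebra.IsAlgebraic E₀ E :=
      Algebra.IsAlgebraic.extendScalars (R := ℚ) (algebraMap ℚ E₀).injective
    let f : E →ₐ[E₀] ℂ := IsAlgClosed.lift
    obtain ⟨r, hr⟩ := key x x.2 f.toRingHom
    exact ⟨r, by rw [← hr]; exact (f.commutes x).symm⟩
  · have hli : LinearIndependent E₀ ![(1 : E), a] := by
      rw [LinearIndependent.pair_iff]
      intro s t h
      have hs := (hmem _).1 s.2
      have ht := (hmem _).1 t.2
      have h : (s : E) * 1 + t * a = 0 := h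
      have h' := congrArg τ h
      simp only [map_add, map_mul, hs, ht, ha, map_one, map_zero] at h'
      have h1 : (s : E) = 0 := by linear_combination (h + h') / 2
      have h2 : (t : E) * a = 0 := by linear_combination (h - h') / 2
      exact ⟨Subtype.ext h1, Subtype.ext ((mul_eq_zero.mp h2).resolve_right ha0)⟩
    have hsp : ⊤ ≤ Submodule.span E₀ (Set.range ![(1 : E), a]) := by
      intro x _
      have hu : (x + τ x) / 2 ∈ E₀ := by
        rw [hmem, map_div₀, map_add, hinv, map_ofNat, add_comm]
      have hv : (x - τ x) / (2 * a) ∈ E₀ := by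
        rw [hmem, map_div₀, map_sub, hinv, map_mul, map_ofNat, ha]
        field_simp
        ring
      rw [Matrix.range_cons, Matrix.range_cons, Matrix.range_empty, Set.union_empty,
        Set.singleton_union, Submodule.mem_span_pair]
      refine ⟨⟨_, hu⟩, ⟨_, hv⟩, ?_⟩
      change (x + τ x) / 2 * 1 + (x - τ x) / (2 * a) * a = x
      field_simp
      ring
    simpa using Module.finrank_eq_card_basis (Module.Basis.mk hli hsp)
  · intro σ
    refine ⟨a, fun s hs => ?_⟩
    obtain ⟨r, hr, h⟩ := hpos a ha0 σ
    rw [ha, map_mul, map_neg, hs] at h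
    have h : s * -s = r := by exact_mod_cast h
    nlinarith [mul_self_nonneg s]
end

section
/- Let (V_ℚ, {V^{p,q}}, h) and (W_ℚ, {W^{p,q}}, h') be rational polarized Hodge structures of the same weight w, and f : V_ℚ → W_ℚ a morphism of Hodge structures, i.e., a ℚ-linear map whose complexification f_ℂ maps V^{p,q} into W^{p,q} for all p, q. Let V^{tr} ⊆ V_ℂ and W^{tr} ⊆ W_ℂ be the smallest rational subspaces containing V^{w,0} and W^{w,0} respectively. If f_ℂ is injective on V^{w,0}, then f_ℂ is injective on V^{tr}; if moreover f_ℂ maps V^{w,0} isomorphically onto W^{w,0}, then f_ℂ maps V^{tr} isomorphically onto W^{tr}. -/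
open TensorProduct

noncomputable section

variable (V : Type) [AddCommGroup V] [Module ℚ V]

/-- A complex subspace `T ⊆ V_ℂ` is rational if it is spanned over `ℂ`
by `T ∩ (V_ℚ ⊗ 1)`. -/
def IsRationalSubspace (T : Submodule ℂ (ℂ ⊗[ℚ] V)) : Prop :=
  T = Submodule.span ℂ ((T : Set (ℂ ⊗[ℚ] V)) ∩ Set.range (incl V))

/-- The transcendental lattice: the smallest rational subspace of `V_ℂ`
containing `V^{w,0}`. -/
def transcendental {w : ℕ} (HS : HodgeStructure V w) : Submodule ℂ (ℂ ⊗[ℚ] V) :=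
  sInf {T : Submodule ℂ (ℂ ⊗[ℚ] V) | IsRationalSubspace V T ∧ HS.H w ≤ T}

/-- Contraction of the complex factor of `U_ℂ` by a rational functional on `ℂ`. -/
def slice {U : Type} [AddCommGroup U] [Module ℚ U] (φ : ℂ →ₗ[ℚ] ℚ) : ℂ ⊗[ℚ] U →ₗ[ℚ] U :=
  (TensorProduct.lid ℚ U).toLinearMap ∘ₗ LinearMap.rTensor U φ

lemma slice_tmul {U : Type} [AddCommGroup U] [Module ℚ U] (φ : ℂ →ₗ[ℚ] ℚ) (c : ℂ) (u : U) :
    slice φ (c ⊗ₜ[ℚ] u) = φ c • u := by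
  simp [slice]

lemma rational_iff {U : Type} [AddCommGroup U] [Module ℚ U] (T : Submodule ℂ (ℂ ⊗[ℚ] U)) :
    IsRationalSubspace U T ↔ ∀ x ∈ T, ∀ φ : ℂ →ₗ[ℚ] ℚ, incl U (slice φ x) ∈ T := by
  constructor
  · intro h x hx φ
    have key : ∀ x ∈ Submodule.span ℂ ((T : Set (ℂ ⊗[ℚ] U)) ∩ Set.range (incl U)),
        ∀ φ : ℂ →ₗ[ℚ] ℚ, incl U (slice φ x) ∈ T := by
      intro x hx
      induction hx using Submodule.span_induction with
      | mem x hx =>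
        obtain ⟨hx, u, rfl⟩ := hx
        intro φ
        have : incl U (slice φ (incl U u)) = ((φ 1 : ℚ) : ℂ) • incl U u := by
          change incl U (slice φ ((1 : ℂ) ⊗ₜ[ℚ] u)) = _
          rw [slice_tmul, map_smul]
          exact (Rat.cast_smul_eq_qsmul ℂ _ _).symm
        rw [this]
        exact T.smul_mem _ hx
      | zero => intro φ; simp
      | add x y _ _ hx hy => intro φ; simpa using T.add_mem (hx φ) (hy φ)
      | smul a x _ hx =>
        intro φ
        have : slice φ (a • x) = slice (φ ∘ₗ LinearMap.mulLeft ℚ a) x := by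
          induction x using TensorProduct.induction_on with
          | zero => simp
          | tmul c u => simp [TensorProduct.smul_tmul', slice_tmul]
          | add x y h1 h2 =>
            clear hx
            have e : ∀ z : ℂ ⊗[ℚ] U,
              slice φ (a • z) = slice (φ ∘ₗ LinearMap.mulLeft ℚ a) z := by
              intro z
              induction z using TensorProduct.induction_on with
              | zero => simp
              | tmul c u => simp [TensorProduct.smul_tmul', slice_tmul]
              | add x y h1 h2 => rw [smul_add, map_add, map_add, h1, h2]
            exact e _
        rw [this]
        exact hx _
    rw [h] at hx
    exact key x hx φ
  · intro h
    apply le_antisymm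
    · intro x hx
      let b := Module.Basis.ofVectorSpace ℚ ℂ
      have e := (TensorProduct.equivFinsuppOfBasisLeft (N := U) b).symm_apply_apply x
      rw [TensorProduct.equivFinsuppOfBasisLeft_symm_apply] at e
      rw [← e]
      apply Submodule.sum_mem
      intro i _
      rw [TensorProduct.equivFinsuppOfBasisLeft_apply]
      have h1 := h x hx (b.coord i)
      have : b i ⊗ₜ[ℚ] ((TensorProduct.lid ℚ U) ((b.coord i).rTensor _ x))
          = b i • incl U (slice (b.coord i) x) := by
        simp [incl, slice, TensorProduct.smul_tmul']
      simp only [this]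
      exact Submodule.smul_mem _ _ (Submodule.subset_span ⟨h1, _, rfl⟩)
    · rw [Submodule.span_le]
      exact fun x hx => hx.1

lemma slice_baseChange {U U' : Type} [AddCommGroup U] [Module ℚ U] [AddCommGroup U']
    [Module ℚ U'] (f : U →ₗ[ℚ] U') (φ : ℂ →ₗ[ℚ] ℚ) (x : ℂ ⊗[ℚ] U) :
    incl U' (slice φ (LinearMap.baseChange ℂ f x)) =
      LinearMap.baseChange ℂ f (incl U (slice φ x)) := by
  have : slice φ (LinearMap.baseChange ℂ f x) = f (slice φ x) := by
    induction x using TensorProduct.induction_on with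
    | zero => simp
    | tmul c u => simp [slice_tmul]
    | add x y h1 h2 => simp only [map_add, h1, h2]
  rw [this]
  simp [incl]

lemma conj_baseChange {U U' : Type} [AddCommGroup U] [Module ℚ U] [AddCommGroup U']
    [Module ℚ U'] (f : U →ₗ[ℚ] U') (x : ℂ ⊗[ℚ] U) :
    LinearMap.baseChange ℂ f (conjV U x) = conjV U' (LinearMap.baseChange ℂ f x) := by
  induction x using TensorProduct.induction_on with
  | zero => simp
  | tmul c u => simp [conjV]
  | add x y h1 h2 => simp only [map_add, h1, h2]

lemma conj_conj {U : Type} [AddCommGroup U] [Module ℚ U] (x : ℂ ⊗[ℚ] U) :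
    conjV U (conjV U x) = x := by
  induction x using TensorProduct.induction_on with
  | zero => simp
  | tmul c u => simp [conjV, conjQ]
  | add x y h1 h2 => simp only [map_add, h1, h2]

lemma transcendental_rational {U : Type} [AddCommGroup U] [Module ℚ U] {w : ℕ}
    (HS : HodgeStructure U w) : IsRationalSubspace U (transcendental U HS) := by
  rw [rational_iff]
  intro x hx φ
  unfold transcendental at hx ⊢
  rw [Submodule.mem_sInf] at hx ⊢
  intro T hT
  exact (rational_iff T).1 hT.1 x (hx T hT) φ

lemma le_transcendental {U : Type} [AddCommGroup U] [Module ℚ U] {w : ℕ}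
    (HS : HodgeStructure U w) : HS.H w ≤ transcendental U HS :=
  le_sInf fun _ hT => hT.2

lemma slice_pol {U : Type} [AddCommGroup U] [Module ℚ U] {w : ℕ}
    (P : PolarizedHodgeStructure U w) (k : U) (φ : ℂ →ₗ[ℚ] ℚ) (y : ℂ ⊗[ℚ] U) :
    P.polC (incl U k) (incl U (slice φ y)) = ((φ (P.polC (incl U k) y) : ℚ) : ℂ) := by
  rw [P.polC_ext]
  congr 1
  induction y using TensorProduct.induction_on with
  | zero => simp
  | tmul c u =>
    have : c ⊗ₜ[ℚ] u = c • incl U u := by simp [incl, TensorProduct.smul_tmul']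
    have h2 : P.polC (incl U k) (c ⊗ₜ[ℚ] u) = (P.pol k u) • c := by
      rw [this, map_smul, P.polC_ext, Rat.smul_def, smul_eq_mul, mul_comm]
    rw [h2, slice_tmul, map_smul, map_smul, smul_eq_mul, smul_eq_mul, mul_comm]
  | add x y h1 h2 => simp only [map_add, h1, h2]

/-- The kernel of a morphism is graded. -/
lemma ker_decomp {U U' : Type} [AddCommGroup U] [Module ℚ U] [AddCommGroup U']
    [Module ℚ U'] {w : ℕ} (P : HodgeStructure U w) (P' : HodgeStructure U' w)
    (f : U →ₗ[ℚ] U') (hf : ∀ p, ∀ x ∈ P.H p, LinearMap.baseChange ℂ f x ∈ P'.H p)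
    (x : ℂ ⊗[ℚ] U) (hx : LinearMap.baseChange ℂ f x = 0) :
    ∃ (s : Finset ℕ) (v : ℕ → ℂ ⊗[ℚ] U), (∀ p ∈ s, v p ∈ P.H p) ∧
      (∀ p ∈ s, LinearMap.baseChange ℂ f (v p) = 0) ∧ x = ∑ p ∈ s, v p := by
  have hx' : x ∈ ⨆ p, P.H p := by rw [P.total]; trivial
  obtain ⟨v, hv, rfl⟩ := (Submodule.mem_iSup_iff_exists_finsupp _ _).1 hx'
  refine ⟨v.support, v, fun p _ => hv p, ?_, rfl⟩
  refine (iSupIndep_iff_finsetSum_eq_zero_imp_eq_zero _).1 P'.indep v.support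
    (fun p => LinearMap.baseChange ℂ f (v p)) (fun p _ => hf p _ (hv p)) ?_
  rw [← map_sum]
  exact hx

lemma injective_part {U U' : Type} [AddCommGroup U] [Module ℚ U] [AddCommGroup U']
    [Module ℚ U'] {w : ℕ} (P : PolarizedHodgeStructure U w) (P' : HodgeStructure U' w)
    (f : U →ₗ[ℚ] U') (hf : ∀ p, ∀ x ∈ P.H p, LinearMap.baseChange ℂ f x ∈ P'.H p)
    (hinj : ∀ x ∈ P.H w, LinearMap.baseChange ℂ f x = 0 → x = 0) :
    ∀ x ∈ transcendental U P.toHodgeStructure, LinearMap.baseChange ℂ f x = 0 → x = 0 := by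
  let K : Submodule ℂ (ℂ ⊗[ℚ] U) := LinearMap.ker (LinearMap.baseChange ℂ f)
  have hK : IsRationalSubspace U K := by
    rw [rational_iff]
    intro x hx φ
    have hx : LinearMap.baseChange ℂ f x = 0 := hx
    change LinearMap.baseChange ℂ f _ = 0
    rw [← slice_baseChange, hx]
    simp
  let N : Submodule ℂ (ℂ ⊗[ℚ] U) := ⨅ k : K, LinearMap.ker (P.polC k)
  have hN : ∀ y, y ∈ N ↔ ∀ k ∈ K, P.polC k y = 0 := by
    intro y
    simp [N]
  have hNrat : IsRationalSubspace U N := by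
    rw [rational_iff]
    intro y hy φ
    rw [hN] at hy ⊢
    intro k hk
    rw [hK] at hk
    induction hk using Submodule.span_induction with
    | mem k hk =>
      obtain ⟨hk, u, rfl⟩ := hk
      rw [slice_pol, hy _ hk]
      simp
    | zero => simp
    | add a b _ _ ha hb => simp [ha, hb]
    | smul c a _ ha => simp [ha]
  have hNw : P.H w ≤ N := by
    intro y hy
    rw [hN]
    intro k hk
    obtain ⟨s, v, hv, hv0, rfl⟩ := ker_decomp P.toHodgeStructure P' f hf k hk
    rw [map_sum, LinearMap.sum_apply]
    apply Finset.sum_eq_zero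
    intro p hp
    by_cases h0 : p = 0
    · subst h0
      have h1 : conjV U (v 0) = 0 := by
        apply hinj _ (by simpa using P.conj_mem 0 _ (hv 0 hp))
        rw [conj_baseChange, hv0 0 hp, map_zero]
      have h2 : v 0 = 0 := by rw [← conj_conj (v 0), h1, map_zero]
      simp [h2]
    · exact P.pol_orth p w (by omega) _ (hv p hp) _ hy
  intro x hx hx0
  have hxN : x ∈ N := by
    unfold transcendental at hx
    exact Submodule.mem_sInf.1 hx N ⟨hNrat, hNw⟩
  rw [hN] at hxN
  obtain ⟨s, v, hv, hv0, rfl⟩ := ker_decomp P.toHodgeStructure P' f hf x hx0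
  apply Finset.sum_eq_zero
  intro p hp
  by_contra hne
  have hpw : p ≤ w := by
    by_contra hlt
    have := hv p hp
    rw [P.bounded p (by omega)] at this
    exact hne (by simpa using this)
  obtain ⟨r, hr, hr2⟩ := P.pol_pos p _ (hv p hp) hne
  have hc : conjV U (v p) ∈ P.H (w - p) := P.conj_mem p _ (hv p hp)
  -- the conjugate component pairs with `v p` only
  have hz : P.polC (v p) (conjV U (v p)) = 0 := by
    have sgn : ∀ a b : ℂ ⊗[ℚ] U, P.polC a b = (-1) ^ w * P.polC b a := by
      intro a b
      induction a using TensorProduct.induction_on with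
      | zero => simp
      | add a a' h1 h2 => simp only [map_add, LinearMap.add_apply, h1, h2, mul_add]
      | tmul c u =>
        induction b using TensorProduct.induction_on with
        | zero => simp
        | add b b' h1 h2 => simp only [map_add, LinearMap.add_apply, h1, h2, mul_add]
        | tmul d u' =>
          have e : ∀ (c : ℂ) (u : U), c ⊗ₜ[ℚ] u = c • incl U u := by
            intro c u; simp [incl, TensorProduct.smul_tmul']
          rw [e, e]
          simp only [map_smul, LinearMap.smul_apply, P.polC_ext, smul_eq_mul]
          rw [P.pol_symm u u']
          push_cast
          ring
    have h1 : P.polC (conjV U (v p)) (∑ q ∈ s, v q) = 0 := by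
      apply hxN
      change LinearMap.baseChange ℂ f _ = 0
      rw [conj_baseChange, hv0 p hp, map_zero]
    rw [map_sum, Finset.sum_eq_single_of_mem p hp] at h1
    · rw [sgn, h1, mul_zero]
    · intro q hq hqp
      exact P.pol_orth (w - p) q (by omega) _ hc _ (hv q hq)
  rw [hz, mul_zero] at hr2
  have : r = 0 := by exact_mod_cast hr2.symm
  exact hr.ne' this

/-- let `f : V → W` be a morphism of rational polarized Hodge
structures of weight `w`. If `f_ℂ` is injective on `V^{w,0}`, then `f_ℂ` is
injective on the transcendental lattice `V^{tr}`; if moreover `f_ℂ` maps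
`V^{w,0}` isomorphically onto `W^{w,0}`, then `f_ℂ` maps `V^{tr}`
isomorphically onto `W^{tr}`. -/
theorem transcendental_functoriality [FiniteDimensional ℚ V]
    (W : Type) [AddCommGroup W] [Module ℚ W] [FiniteDimensional ℚ W] (w : ℕ)
    (PV : PolarizedHodgeStructure V w) (PW : PolarizedHodgeStructure W w)
    (f : V →ₗ[ℚ] W)
    (hf : ∀ p, ∀ x ∈ PV.H p, LinearMap.baseChange ℂ f x ∈ PW.H p) :
    ((∀ x ∈ PV.H w, LinearMap.baseChange ℂ f x = 0 → x = 0) →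
      ∀ x ∈ transcendental V PV.toHodgeStructure,
        LinearMap.baseChange ℂ f x = 0 → x = 0) ∧
    (((∀ x ∈ PV.H w, LinearMap.baseChange ℂ f x = 0 → x = 0) ∧
        Submodule.map (LinearMap.baseChange ℂ f) (PV.H w) = PW.H w) →
      ((∀ x ∈ transcendental V PV.toHodgeStructure,
          LinearMap.baseChange ℂ f x = 0 → x = 0) ∧
        Submodule.map (LinearMap.baseChange ℂ f)
            (transcendental V PV.toHodgeStructure) =
          transcendental W PW.toHodgeStructure)) := by
  refine ⟨injective_part PV PW.toHodgeStructure f hf, ?_⟩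
  rintro ⟨hinj, hmap⟩
  refine ⟨injective_part PV PW.toHodgeStructure f hf hinj, le_antisymm ?_ ?_⟩
  · rw [Submodule.map_le_iff_le_comap]
    refine sInf_le ⟨?_, ?_⟩
    · rw [rational_iff]
      intro x hx φ
      rw [Submodule.mem_comap, ← slice_baseChange]
      exact (rational_iff _).1 (transcendental_rational PW.toHodgeStructure) _ hx φ
    · intro x hx
      exact le_transcendental PW.toHodgeStructure (hf w x hx)
  · refine sInf_le ⟨?_, ?_⟩
    · rw [rational_iff]
      rintro _ ⟨x, hx, rfl⟩ φ
      rw [slice_baseChange]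
      exact Submodule.mem_map_of_mem
        ((rational_iff _).1 (transcendental_rational PV.toHodgeStructure) _ hx φ)
    · rw [← hmap]
      exact Submodule.map_mono (le_transcendental PV.toHodgeStructure)
end
end
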